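/- Let n ≥ 2 and let c be a fully invariant congruence on the free monoid M = FreeMonoid ℕ such that c ≤ θ_E and ¬(c ≤ θ_{C_{n+1}}). Let γ be the least fully invariant congruence containing all pairs (x^k*y, y*x^k) with k > n, and δ the least fully invariant congruence containing all pairs (x^k*y, y*x^k) with k ≥ n. Put X = (c ⊓ θ_{C_{n+1}}) ⊔ γ and Y = (c ⊓ θ_{C_{n+1}}) ⊔ δ in the lattice L of fully invariant congruences. Then X < Y, c ⊓ X = c ⊓ Y, and c ⊔ X = c ⊔ Y; consequently c, X, Y generate a five-element non-modular (pentagon) sublattice of L and, in particular, c is not a modular element of L. (Dual rendering of the paper's Lemma: if a monoid variety V contains E and does not contain C_{n+1}, then V is not a modular element of 𝕄𝕆ℕ.) -/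

import Mathlib

/-- The free monoid over a countably infinite alphabet. -/
abbrev M : Type := FreeMonoid ℕ

/-- A congruence on the free monoid is fully invariant if it is stable under
all endomorphisms of the free monoid. -/
def FullyInvariant (c : Con M) : Prop :=
  ∀ f : M →* M, ∀ u v : M, c u v → c (f u) (f v)

/-- The least fully invariant congruence containing a given set of pairs. -/
def fiClosure (S : Set (M × M)) : Con M :=
  sInf {c : Con M | FullyInvariant c ∧ ∀ p ∈ S, c p.1 p.2}

def x : M := FreeMonoid.of 0
def y : M := FreeMonoid.of 1

/-- `θ_{C_n}`, the least fully invariant congruence containing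
`(x^n, x^(n+1))` and `(x*y, y*x)`. -/
def thetaC (n : ℕ) : Con M := fiClosure {(x ^ n, x ^ (n + 1)), (x * y, y * x)}

/-- `θ_E`, the least fully invariant congruence containing `(x^2, x^3)`,
`(x^2*y, x*y*x)` and `(x^2*y^2, y^2*x^2)`. -/
def thetaE : Con M :=
  fiClosure {(x ^ 2, x ^ 3), (x ^ 2 * y, x * y * x), (x ^ 2 * y ^ 2, y ^ 2 * x ^ 2)}

/-- `c` is a modular element of the lattice of fully invariant congruences. -/
def IsModularElem (c : Con M) : Prop :=
  ∀ b d : Con M, FullyInvariant b → FullyInvariant d → b ≤ d →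
    (c ⊔ b) ⊓ d = (c ⊓ d) ⊔ b

theorem fullyInvariant_fiClosure (S : Set (M × M)) : FullyInvariant (fiClosure S) :=
  fun f u v h d hd => hd.1 f u v (h d hd)

theorem subset_fiClosure {S : Set (M × M)} {p : M × M} (hp : p ∈ S) :
    fiClosure S p.1 p.2 :=
  fun _ hd => hd.2 p hp

theorem fiClosure_le {S : Set (M × M)} {d : Con M} (hd : FullyInvariant d)
    (h : ∀ p ∈ S, d p.1 p.2) : fiClosure S ≤ d :=
  sInf_le ⟨hd, h⟩

theorem fiClosure_mono {S T : Set (M × M)} (h : S ⊆ T) : fiClosure S ≤ fiClosure T :=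
  fiClosure_le (fullyInvariant_fiClosure T) fun _ hp => subset_fiClosure (h hp)

/-- The largest fully invariant congruence contained in a given congruence. -/
def fiInterior (d : Con M) : Con M where
  r u v := ∀ f : M →* M, d (f u) (f v)
  iseqv := ⟨fun _ _ => d.refl _, fun h f => d.symm (h f), fun h k f => d.trans (h f) (k f)⟩
  mul' h k f := by
    rw [map_mul f, map_mul f]
    exact d.mul (h f) (k f)

theorem fullyInvariant_fiInterior (d : Con M) : FullyInvariant (fiInterior d) :=
  fun f _ _ h g => h (g.comp f)

theorem fiInterior_le (d : Con M) : fiInterior d ≤ d :=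
  fun {_ _} h => h (MonoidHom.id M)

theorem fiClosure_le_of_forall_hom {S : Set (M × M)} {d : Con M}
    (h : ∀ p ∈ S, ∀ f : M →* M, d (f p.1) (f p.2)) : fiClosure S ≤ d :=
  (fiClosure_le (fullyInvariant_fiInterior d) h).trans (fiInterior_le d)

theorem FullyInvariant.inf {c d : Con M} (hc : FullyInvariant c) (hd : FullyInvariant d) :
    FullyInvariant (c ⊓ d) :=
  fun f u v h => ⟨hc f u v h.1, hd f u v h.2⟩

theorem FullyInvariant.sup {c d : Con M} (hc : FullyInvariant c) (hd : FullyInvariant d) :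
    FullyInvariant (c ⊔ d) := by
  intro f u v h
  have hle : c ⊔ d ≤ (c ⊔ d).comap f (map_mul f) :=
    sup_le (fun {a b} hab => (le_sup_left : c ≤ c ⊔ d) (hc f a b hab))
      (fun {a b} hab => (le_sup_right : d ≤ c ⊔ d) (hd f a b hab))
  exact hle h

/-- The number of occurrences of a letter in a word. -/
def occ (a : ℕ) (u : M) : ℕ := u.toList.count a

theorem occ_mul (a : ℕ) (u v : M) : occ a (u * v) = occ a u + occ a v := by
  simp [occ, FreeMonoid.toList_mul]

theorem occ_one (a : ℕ) : occ a 1 = 0 := by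
  simp [occ]

theorem occ_pow (a : ℕ) (u : M) (k : ℕ) : occ a (u ^ k) = k * occ a u := by
  induction k with
  | zero => simp [occ_one]
  | succ k ih => rw [pow_succ, occ_mul, ih]; ring

theorem eq_one_of_forall_occ_eq_zero {u : M} (h : ∀ a, occ a u = 0) : u = 1 := by
  apply FreeMonoid.toList.injective
  rw [FreeMonoid.toList_one, List.eq_nil_iff_forall_not_mem]
  exact fun a => List.count_eq_zero.mp (h a)

/-- The congruence identifying words in which every letter occurs the same number of times,
numbers of occurrences from `m` on being identified. -/
def occCon (m : ℕ) : Con M where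
  r u v := ∀ a, min (occ a u) m = min (occ a v) m
  iseqv := ⟨fun _ _ => rfl, fun h a => (h a).symm, fun h k a => (h a).trans (k a)⟩
  mul' h k a := by
    have h1 := h a
    have h2 := k a
    rw [occ_mul, occ_mul]
    omega

theorem thetaC_le_occCon (m : ℕ) : thetaC m ≤ occCon m := by
  apply fiClosure_le_of_forall_hom
  rintro p (rfl | rfl) f a
  · simp only [map_pow, occ_pow]
    rcases Nat.eq_zero_or_pos (occ a (f x)) with h | h
    · simp [h]
    · have h1 : m ≤ m * occ a (f x) := Nat.le_mul_of_pos_right m h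
      rw [Nat.succ_mul]
      omega
  · simp only [map_mul, occ_mul, add_comm]

theorem fullyInvariant_thetaC (m : ℕ) : FullyInvariant (thetaC m) :=
  fullyInvariant_fiClosure _

theorem thetaC_mul_comm (m : ℕ) (u v : M) : thetaC m (u * v) (v * u) := by
  have h : thetaC m (x * y) (y * x) := subset_fiClosure (p := (x * y, y * x)) (by simp)
  simpa only [map_mul, x, y, FreeMonoid.lift_eval_of, if_true, one_ne_zero, if_false]
    using fullyInvariant_thetaC m
    (FreeMonoid.lift fun i => if i = 0 then u else v) _ _ h

theorem thetaC_pow (m : ℕ) (u : M) : thetaC m (u ^ m) (u ^ (m + 1)) := by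
  have h : thetaC m (x ^ m) (x ^ (m + 1)) :=
    subset_fiClosure (p := (x ^ m, x ^ (m + 1))) (by simp)
  simpa only [map_pow, x, FreeMonoid.lift_eval_of]
    using fullyInvariant_thetaC m (FreeMonoid.lift fun _ => u) _ _ h

theorem pow_eq_pow_of_min_eq {N : Type*} [Monoid N] {m : ℕ} {q : N}
    (hq : q ^ m = q ^ (m + 1)) {i j : ℕ} (h : min i m = min j m) : q ^ i = q ^ j := by
  have key : ∀ k, q ^ (m + k) = q ^ m := by
    intro k
    induction k with
    | zero => rfl
    | succ k ih => rw [← add_assoc, pow_succ, ih, ← pow_succ, ← hq]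
  have cap : ∀ k, q ^ k = q ^ min k m := by
    intro k
    rcases le_total k m with hk | hk
    · rw [min_eq_left hk]
    · rw [min_eq_right hk, ← key (k - m), Nat.add_sub_cancel' hk]
  rw [cap i, cap j, h]

theorem lift_eq_prod_pow_occ {N : Type*} [CommMonoid N] (g : ℕ → N) (u : M) {s : Finset ℕ}
    (hs : u.toList.toFinset ⊆ s) : FreeMonoid.lift g u = ∏ a ∈ s, g a ^ occ a u := by
  rw [FreeMonoid.lift_apply, Finset.prod_list_map_count]
  refine Finset.prod_subset hs fun a _ ha => ?_
  rw [List.count_eq_zero.mpr (by simpa using ha), pow_zero]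

theorem occCon_le_thetaC (m : ℕ) : occCon m ≤ thetaC m := by
  intro u v h
  let : CommMonoid (thetaC m).Quotient :=
    { (inferInstance : Monoid (thetaC m).Quotient) with
      mul_comm := fun a b => Con.induction_on₂ a b fun u v =>
        (thetaC m).eq.mpr (thetaC_mul_comm m u v) }
  let g : ℕ → (thetaC m).Quotient := fun a => (FreeMonoid.of a : M)
  have hg : ∀ w : M, ((w : M) : (thetaC m).Quotient) = FreeMonoid.lift g w := by
    intro w
    have : (thetaC m).mk' = FreeMonoid.lift g := FreeMonoid.hom_eq fun a => by simp [g]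
    exact DFunLike.congr_fun this w
  rw [← Con.eq, hg, hg, lift_eq_prod_pow_occ g u Finset.subset_union_left,
    lift_eq_prod_pow_occ g v Finset.subset_union_right]
  exact Finset.prod_congr rfl fun a _ =>
    pow_eq_pow_of_min_eq ((thetaC m).eq.mpr (thetaC_pow m (FreeMonoid.of a))) (h a)

/-- The five-element monoid `⟨a, b | a² = a, b² = 0, ba = b⟩`. -/
inductive EMonoid
  | one | a | b | ab | zero
  deriving DecidableEq

namespace EMonoid

instance : Fintype EMonoid where
  elems := {one, a, b, ab, zero}
  complete s := by cases s <;> decide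

/-- Multiplication of `EMonoid`. -/
def mul : EMonoid → EMonoid → EMonoid
  | one, s => s
  | s, one => s
  | zero, _ => zero
  | _, zero => zero
  | a, a => a
  | a, b => ab
  | a, ab => ab
  | b, a => b
  | b, _ => zero
  | ab, a => ab
  | ab, _ => zero

instance : Monoid EMonoid where
  mul := mul
  one := one
  mul_assoc := by decide
  one_mul := by decide
  mul_one := by decide

theorem sq_eq_cube : ∀ s : EMonoid, s * s = s * s * s := by decide

theorem sq_mul_eq : ∀ s t : EMonoid, s * s * t = s * t * s := by decide

theorem sq_mul_sq_comm : ∀ s t : EMonoid, s * s * (t * t) = t * t * (s * s) := by decide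

theorem a_mul_a : a * a = a := rfl

theorem a_pow {n : ℕ} (hn : n ≠ 0) : a ^ n = a :=
  IsIdempotentElem.pow_eq a_mul_a hn

end EMonoid

theorem thetaE_le_ker (φ : M →* EMonoid) : thetaE ≤ Con.ker φ := by
  apply fiClosure_le_of_forall_hom
  rintro p (rfl | rfl | rfl) f
  · simpa [Con.ker_rel, pow_succ] using EMonoid.sq_eq_cube (φ (f x))
  · simpa [Con.ker_rel, pow_succ] using EMonoid.sq_mul_eq (φ (f x)) (φ (f y))
  · simpa [Con.ker_rel, pow_succ] using EMonoid.sq_mul_sq_comm (φ (f x)) (φ (f y))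

/-- The congruence refining `occCon (n + 1)` in which words all of whose letters occur at most
`n` times must moreover have the same image under `φ`. -/
def sparseCon (n : ℕ) (φ : M →* EMonoid) : Con M where
  r u v := occCon (n + 1) u v ∧ ((∀ a, occ a u ≤ n) → φ u = φ v)
  iseqv := by
    have hsymm : ∀ {u v : M}, occCon (n + 1) u v → (∀ a, occ a u ≤ n) → ∀ a, occ a v ≤ n := by
      intro u v h hu a
      have h1 : min (occ a u) (n + 1) = min (occ a v) (n + 1) := h a
      have h2 := hu a
      omega
    refine ⟨fun u => ⟨Con.refl _ u, fun _ => rfl⟩, fun h => ?_, fun h k => ?_⟩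
    · exact ⟨Con.symm _ h.1, fun hv => (h.2 (hsymm (Con.symm _ h.1) hv)).symm⟩
    · exact ⟨Con.trans _ h.1 k.1, fun hu => (h.2 hu).trans (k.2 (hsymm h.1 hu))⟩
  mul' {u v u' v'} h k := by
    refine ⟨Con.mul _ h.1 k.1, fun hu => ?_⟩
    simp only [occ_mul] at hu
    rw [map_mul, map_mul, h.2 fun a => by have := hu a; omega,
      k.2 fun a => by have := hu a; omega]

theorem le_sparseCon {c : Con M} (hcE : c ≤ thetaE) (n : ℕ) (φ : M →* EMonoid) :
    c ⊓ thetaC (n + 1) ≤ sparseCon n φ :=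
  fun {_ _} h => ⟨thetaC_le_occCon _ h.2, fun _ => thetaE_le_ker φ (hcE h.1)⟩

theorem powComm_le_sparseCon (n : ℕ) (φ : M →* EMonoid) :
    fiClosure {p : M × M | ∃ k > n, p = (x ^ k * y, y * x ^ k)} ≤ sparseCon n φ := by
  apply fiClosure_le_of_forall_hom
  rintro p ⟨k, hk, rfl⟩ f
  refine ⟨fun a => by simp only [map_mul, occ_mul, add_comm], fun h => ?_⟩
  have hx : f x = 1 := by
    refine eq_one_of_forall_occ_eq_zero fun a => ?_
    have ha := h a
    simp only [map_mul, map_pow, occ_mul, occ_pow] at ha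
    by_contra h0
    have := Nat.le_mul_of_pos_right k (Nat.pos_of_ne_zero h0)
    omega
  simp [hx]

theorem not_sparseCon {n : ℕ} (hn : 1 ≤ n) :
    ¬ sparseCon n (FreeMonoid.lift fun i => if i = 0 then EMonoid.a else EMonoid.b)
      (x ^ n * y) (y * x ^ n) := by
  intro h
  have h1 := h.2 fun a => by
    rw [occ_mul, occ_pow]
    by_cases h0 : a = 0
    · simp [h0, occ, x, y]
    · have hx : occ a x = 0 := by simp [occ, x, Ne.symm h0]
      have hy : occ a y ≤ 1 := List.count_le_length
      rw [hx]
      omega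
  simp only [map_mul, map_pow, x, y, FreeMonoid.lift_eval_of, if_true, one_ne_zero, if_false,
    EMonoid.a_pow (Nat.one_le_iff_ne_zero.mp hn)] at h1
  exact absurd h1 (by decide)

theorem lift_ite_eq_pow_occ (a : ℕ) (u : M) :
    FreeMonoid.lift (fun i => if i = a then x else 1) u = x ^ occ a u := by
  induction u using FreeMonoid.inductionOn' with
  | one => simp [occ_one]
  | of_mul i u ih =>
    rw [map_mul, ih, occ_mul, pow_add, FreeMonoid.lift_eval_of]
    congr 1
    by_cases h : i = a
    · simp [h, occ]
    · simp [h, occ]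

theorem exists_pow_of_not_le_thetaC {c : Con M} (hc : FullyInvariant c) {n : ℕ}
    (hcC : ¬ c ≤ thetaC (n + 1)) : ∃ k > n, c (x ^ n) (x ^ k) := by
  have key : ∀ i j, i < j → i ≤ n → c (x ^ i) (x ^ j) → ∃ k > n, c (x ^ n) (x ^ k) := by
    intro i j hij hi h
    refine ⟨n - i + j, by omega, ?_⟩
    have := c.mul (c.refl (x ^ (n - i))) h
    rwa [← pow_add, ← pow_add, Nat.sub_add_cancel hi] at this
  by_contra hno
  refine hcC (le_trans ?_ (occCon_le_thetaC (n + 1)))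
  intro u v huv a
  have h := hc (FreeMonoid.lift fun i => if i = a then x else 1) u v huv
  rw [lift_ite_eq_pow_occ, lift_ite_eq_pow_occ] at h
  by_contra hne
  rcases lt_trichotomy (occ a u) (occ a v) with hlt | heq | hlt
  · exact hno (key _ _ hlt (by omega) h)
  · exact hne (by rw [heq])
  · exact hno (key _ _ hlt (by omega) (c.symm h))

theorem powComm_le_sup {c : Con M} (hc : FullyInvariant c) {n : ℕ}
    (hcC : ¬ c ≤ thetaC (n + 1)) :
    fiClosure {p : M × M | ∃ k ≥ n, p = (x ^ k * y, y * x ^ k)} ≤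
      c ⊔ fiClosure {p : M × M | ∃ k > n, p = (x ^ k * y, y * x ^ k)} := by
  set γ := fiClosure {p : M × M | ∃ k > n, p = (x ^ k * y, y * x ^ k)}
  have hγ : ∀ k > n, (c ⊔ γ) (x ^ k * y) (y * x ^ k) := fun k hk =>
    (le_sup_right : γ ≤ c ⊔ γ) (subset_fiClosure (p := (x ^ k * y, y * x ^ k)) ⟨k, hk, rfl⟩)
  refine fiClosure_le (hc.sup (fullyInvariant_fiClosure _)) ?_
  rintro p ⟨k, hk, rfl⟩
  rcases hk.eq_or_lt with rfl | hlt
  · obtain ⟨m, hm, h⟩ := exists_pow_of_not_le_thetaC hc hcC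
    have h' : (c ⊔ γ) (x ^ n) (x ^ m) := (le_sup_left : c ≤ c ⊔ γ) h
    exact Con.trans _ (Con.mul _ h' (Con.refl _ y))
      (Con.trans _ (hγ m hm) (Con.mul _ (Con.refl _ y) (Con.symm _ h')))
  · exact hγ k hlt

theorem powComm_le_thetaC (n m : ℕ) :
    fiClosure {p : M × M | ∃ k ≥ n, p = (x ^ k * y, y * x ^ k)} ≤ thetaC m := by
  refine fiClosure_le (fullyInvariant_fiClosure _) ?_
  rintro p ⟨k, _, rfl⟩
  exact thetaC_mul_comm m (x ^ k) y

/-- Dual rendering of the paper's Lemma: let `n ≥ 2`, let `c` be a fully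
invariant congruence with `c ≤ θ_E` and `¬(c ≤ θ_{C_{n+1}})`; with
`γ` the least fully invariant congruence containing all pairs `(x^k*y, y*x^k)`
with `k > n`, `δ` the one for `k ≥ n`, `X = (c ⊓ θ_{C_{n+1}}) ⊔ γ` and
`Y = (c ⊓ θ_{C_{n+1}}) ⊔ δ`, we have `X < Y`, `c ⊓ X = c ⊓ Y` and
`c ⊔ X = c ⊔ Y`, so that `c`, `X`, `Y` generate a pentagon; in particular `c`
is not a modular element of the lattice of fully invariant congruences. -/
theorem not_modular_of_le_thetaE (n : ℕ) (hn : 2 ≤ n) (c : Con M)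
    (hc : FullyInvariant c) (hcE : c ≤ thetaE) (hcC : ¬ c ≤ thetaC (n + 1)) :
    ∀ γ δ X Y : Con M,
      γ = fiClosure {p : M × M | ∃ k > n, p = (x ^ k * y, y * x ^ k)} →
      δ = fiClosure {p : M × M | ∃ k ≥ n, p = (x ^ k * y, y * x ^ k)} →
      X = (c ⊓ thetaC (n + 1)) ⊔ γ →
      Y = (c ⊓ thetaC (n + 1)) ⊔ δ →
      X < Y ∧ c ⊓ X = c ⊓ Y ∧ c ⊔ X = c ⊔ Y ∧ ¬ IsModularElem c := by
  intro γ δ X Y hγ hδ hX hY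
  have hγδ : γ ≤ δ := by
    rw [hγ, hδ]
    exact fiClosure_mono fun p ⟨k, hk, hp⟩ => ⟨k, le_of_lt hk, hp⟩
  have hXY : X ≤ Y := by
    rw [hX, hY]
    exact sup_le_sup_left hγδ _
  have hlt : X < Y := by
    refine lt_of_le_not_ge hXY fun hYX => not_sparseCon (one_le_two.trans hn) ?_
    have hXs : X ≤ sparseCon n
        (FreeMonoid.lift fun i => if i = 0 then EMonoid.a else EMonoid.b) := by
      rw [hX, hγ]
      exact sup_le (le_sparseCon hcE n _) (powComm_le_sparseCon n _)
    have hδY : δ ≤ Y := hY ▸ le_sup_right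
    refine hXs (hYX (hδY ?_))
    rw [hδ]
    exact subset_fiClosure (p := (x ^ n * y, y * x ^ n)) ⟨n, le_rfl, rfl⟩
  have hinf : c ⊓ X = c ⊓ Y := by
    refine le_antisymm (inf_le_inf_left c hXY) (le_inf inf_le_left ?_)
    have hYC : Y ≤ thetaC (n + 1) := by
      rw [hY, hδ]
      exact sup_le inf_le_right (powComm_le_thetaC n _)
    exact (inf_le_inf_left c hYC).trans (hX ▸ le_sup_left)
  have hsup : c ⊔ X = c ⊔ Y := by
    refine le_antisymm (sup_le_sup_left hXY c) (sup_le le_sup_left ?_)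
    have hγX : γ ≤ X := hX ▸ le_sup_right
    have hδ' : δ ≤ c ⊔ γ := by
      rw [hδ, hγ]
      exact powComm_le_sup hc hcC
    rw [hY]
    exact sup_le (inf_le_left.trans le_sup_left) (hδ'.trans (sup_le_sup_left hγX c))
  refine ⟨hlt, hinf, hsup, fun hmod => hlt.ne ?_⟩
  have hC : FullyInvariant (c ⊓ thetaC (n + 1)) := hc.inf (fullyInvariant_thetaC _)
  have hXfi : FullyInvariant X := by
    rw [hX, hγ]
    exact hC.sup (fullyInvariant_fiClosure _)
  have hYfi : FullyInvariant Y := by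
    rw [hY, hδ]
    exact hC.sup (fullyInvariant_fiClosure _)
  have h := hmod X Y hXfi hYfi hXY
  rw [hsup, ← hinf, inf_eq_right.mpr le_sup_right, sup_eq_right.mpr inf_le_right] at h
  exact h.symm
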